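/- arXiv:1011.6214 — 6 statements merged into one kernel-verified Lean document; each statement's English description precedes it below -/
import Mathlib

section
/- Let ν > 0, A > 0, c_β > 0, α ∈ (0,1), β ∈ (α, 2), and γ ∈ (0,1) with γ > α + 1 − β. Then there exists a constant C₁ > 0, depending only on α, β, γ, ν, A, c_β, such that for all H, δ > 0 with H ≤ C₁ δ^{α+1−β}, for every ξ ∈ (0, δ] and every real number U ≤ 0, one has A·(−ξ^{β−α} U + ξ^{−α} ω_{H,δ,γ}(ξ)) · γ H δ^{−γ} ξ^{γ−1} + ν c_β · Υ_β[ω_{H,δ,γ}](ξ) + ν U < 0. -/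
open MeasureTheory Set Real

/-- The Hölder-type modulus of continuity `ω_{H,δ,γ}` from (5.4):
`ω(ξ) = (H/δ^γ) ξ^γ` for `0 < ξ ≤ δ` and `ω(ξ) = H` for `ξ > δ`. -/
noncomputable def omegaH (H δ γ ξ : ℝ) : ℝ :=
  if ξ ≤ δ then H / δ ^ γ * ξ ^ γ else H

/-- The dissipation functional `Υ_β[ω](ξ)`. -/
noncomputable def Upsilon (β : ℝ) (ω : ℝ → ℝ) (ξ : ℝ) : ℝ :=
  (∫ η in Set.Ioc (0 : ℝ) (ξ / 2),
      (ω (ξ + 2 * η) + ω (ξ - 2 * η) - 2 * ω ξ) / η ^ (1 + β)) +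
    ∫ η in Set.Ioi (ξ / 2), (ω (2 * η + ξ) - ω (2 * η - ξ) - 2 * ω ξ) / η ^ (1 + β)

lemma omegaH_eq_mul_min_rpow {H δ γ : ℝ} (hδ : 0 < δ) (x : ℝ) :
    omegaH H δ γ x = H / δ ^ γ * (min x δ) ^ γ := by
  unfold omegaH
  split_ifs with h
  · rw [min_eq_left h]
  · rw [min_eq_right (not_le.mp h).le, div_mul_cancel₀ _ (rpow_pos_of_pos hδ γ).ne']

lemma omegaH_nonneg {H δ γ x : ℝ} (hH : 0 ≤ H) (hδ : 0 < δ) (hx : 0 ≤ x) :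
    0 ≤ omegaH H δ γ x := by
  rw [omegaH_eq_mul_min_rpow hδ]
  have : 0 ≤ min x δ := le_min hx hδ.le
  positivity

lemma omegaH_le {H δ γ x : ℝ} (hH : 0 ≤ H) (hδ : 0 < δ) (hγ : 0 ≤ γ) (hx : 0 ≤ x) :
    omegaH H δ γ x ≤ H := by
  rw [omegaH_eq_mul_min_rpow hδ]
  calc H / δ ^ γ * (min x δ) ^ γ ≤ H / δ ^ γ * δ ^ γ := by
        gcongr
        exact min_le_right _ _
    _ = H := div_mul_cancel₀ _ (rpow_pos_of_pos hδ γ).ne'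

lemma measurable_omegaH (H δ γ : ℝ) : Measurable (omegaH H δ γ) := by
  unfold omegaH
  exact Measurable.ite measurableSet_Iic (by fun_prop) measurable_const

/-- Midpoint concavity of `omegaH`. -/
lemma omegaH_add_add_omegaH_sub_le {H δ γ x h : ℝ} (hH : 0 ≤ H) (hδ : 0 < δ) (hγ₀ : 0 ≤ γ)
    (hγ₁ : γ ≤ 1) (hx₁ : 0 ≤ x + h) (hx₂ : 0 ≤ x - h) :
    omegaH H δ γ (x + h) + omegaH H δ γ (x - h) ≤ 2 * omegaH H δ γ x := by
  simp only [omegaH_eq_mul_min_rpow hδ]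
  have ha : 0 ≤ min (x + h) δ := le_min hx₁ hδ.le
  have hb : 0 ≤ min (x - h) δ := le_min hx₂ hδ.le
  have key := (concaveOn_rpow hγ₀ hγ₁).2 ha hb (by norm_num : (0 : ℝ) ≤ 1 / 2)
    (by norm_num : (0 : ℝ) ≤ 1 / 2) (by norm_num)
  simp only [smul_eq_mul] at key
  have hle : 1 / 2 * min (x + h) δ + 1 / 2 * min (x - h) δ ≤ min x δ := by
    apply le_min
    · linarith [min_le_left (x + h) δ, min_le_left (x - h) δ]
    · linarith [min_le_right (x + h) δ, min_le_right (x - h) δ]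
  have mono := rpow_le_rpow (by positivity) hle hγ₀
  have hK : 0 ≤ H / δ ^ γ := by positivity
  have := mul_le_mul_of_nonneg_left (key.trans mono) hK
  linarith

lemma omegaH_add_le {H δ γ x y : ℝ} (hH : 0 ≤ H) (hδ : 0 < δ) (hγ₀ : 0 ≤ γ) (hγ₁ : γ ≤ 1)
    (hx : 0 ≤ x) (hy : 0 ≤ y) :
    omegaH H δ γ (x + y) ≤ omegaH H δ γ x + omegaH H δ γ y := by
  simp only [omegaH_eq_mul_min_rpow hδ]
  have hx' : 0 ≤ min x δ := le_min hx hδ.le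
  have hy' : 0 ≤ min y δ := le_min hy hδ.le
  rw [← mul_add]
  gcongr
  refine (rpow_le_rpow (le_min (by positivity) hδ.le) ?_ hγ₀).trans
    (rpow_add_le_add_rpow hx' hy' hγ₀ hγ₁)
  rcases le_total x δ with h | h <;> rcases le_total y δ with h' | h' <;>
    simp only [min_eq_left, min_eq_right, h, h'] <;>
    first
    | exact min_le_left _ _
    | exact (min_le_right _ _).trans (by linarith)

lemma omegaH_two_mul_le {H δ γ x : ℝ} (hH : 0 ≤ H) (hδ : 0 < δ) (hγ : 0 ≤ γ)
    (hx : 0 ≤ x) (hxδ : x ≤ δ) :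
    omegaH H δ γ (2 * x) ≤ 2 ^ γ * omegaH H δ γ x := by
  simp only [omegaH_eq_mul_min_rpow hδ, min_eq_left hxδ]
  calc H / δ ^ γ * (min (2 * x) δ) ^ γ ≤ H / δ ^ γ * (2 * x) ^ γ := by
        gcongr
        exact min_le_left _ _
    _ = 2 ^ γ * (H / δ ^ γ * x ^ γ) := by
        rw [mul_rpow zero_le_two hx]; ring

/-- The dissipation of `omegaH` is bounded by a negative multiple of `ω(ξ) ξ^{-β}`. -/
lemma Upsilon_omegaH_le {β γ H δ ξ : ℝ} (hβ : 0 < β) (hγ₀ : 0 ≤ γ) (hγ₁ : γ ≤ 1) (hH : 0 ≤ H)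
    (hξ : 0 < ξ) (hξδ : ξ ≤ δ) :
    Upsilon β (omegaH H δ γ) ξ ≤
      -((2 - 2 ^ γ) * 2 ^ β / β * (omegaH H δ γ ξ * ξ ^ (-β))) := by
  have hδ : 0 < δ := hξ.trans_le hξδ
  have hnear : (∫ η in Set.Ioc (0 : ℝ) (ξ / 2),
      (omegaH H δ γ (ξ + 2 * η) + omegaH H δ γ (ξ - 2 * η) - 2 * omegaH H δ γ ξ) /
        η ^ (1 + β)) ≤ 0 := by
    refine setIntegral_nonpos measurableSet_Ioc fun η hη => ?_
    have := omegaH_add_add_omegaH_sub_le hH hδ hγ₀ hγ₁ (x := ξ) (h := 2 * η)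
      (by linarith [hη.1]) (by linarith [hη.2])
    exact div_nonpos_of_nonpos_of_nonneg (by linarith) (rpow_nonneg hη.1.le _)
  have hker : IntegrableOn (fun η : ℝ => η ^ (-1 - β)) (Set.Ioi (ξ / 2)) :=
    integrableOn_Ioi_rpow_of_lt (by linarith) (by positivity)
  have hdiv : ∀ a : ℝ, ∀ η ∈ Set.Ioi (ξ / 2), a / η ^ (1 + β) = a * η ^ (-1 - β) := by
    intro a η hη
    have hη' : 0 < η := lt_trans (by positivity) hη
    rw [show -1 - β = -(1 + β) by ring, rpow_neg hη'.le, div_eq_mul_inv]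
  have hmeas := measurable_omegaH H δ γ
  have hfar : (∫ η in Set.Ioi (ξ / 2),
      (omegaH H δ γ (2 * η + ξ) - omegaH H δ γ (2 * η - ξ) - 2 * omegaH H δ γ ξ) /
        η ^ (1 + β)) ≤
      ∫ η in Set.Ioi (ξ / 2), -((2 - 2 ^ γ) * omegaH H δ γ ξ) * η ^ (-1 - β) := by
    rw [setIntegral_congr_fun measurableSet_Ioi fun η hη => hdiv _ η hη]
    refine setIntegral_mono_on ?_ (hker.const_mul _) measurableSet_Ioi fun η hη => ?_
    · refine Integrable.bdd_mul (c := 3 * H) hker ?_ ?_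
      · exact Measurable.aestronglyMeasurable (by fun_prop)
      · refine (ae_restrict_iff' measurableSet_Ioi).mpr (Filter.Eventually.of_forall fun η hη => ?_)
        have hη' : ξ / 2 < η := hη
        have h₁ : 0 ≤ 2 * η + ξ := by linarith
        have h₂ : 0 ≤ 2 * η - ξ := by linarith
        rw [Real.norm_eq_abs, abs_le]
        constructor <;> linarith [omegaH_nonneg (γ := γ) hH hδ h₁, omegaH_nonneg (γ := γ) hH hδ h₂,
          omegaH_nonneg (γ := γ) hH hδ hξ.le, omegaH_le hH hδ hγ₀ h₁, omegaH_le hH hδ hγ₀ h₂,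
          omegaH_le hH hδ hγ₀ hξ.le]
    · have hη' : ξ / 2 < η := hη
      have hadd := omegaH_add_le hH hδ hγ₀ hγ₁ (x := 2 * η - ξ) (y := 2 * ξ)
        (by linarith) (by linarith)
      rw [show 2 * η - ξ + 2 * ξ = 2 * η + ξ by ring] at hadd
      have htwo := omegaH_two_mul_le hH hδ hγ₀ hξ.le hξδ
      exact mul_le_mul_of_nonneg_right (by linarith) (rpow_nonneg (by linarith) _)
  have hval : (∫ η in Set.Ioi (ξ / 2), -((2 - 2 ^ γ) * omegaH H δ γ ξ) * η ^ (-1 - β)) =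
      -((2 - 2 ^ γ) * 2 ^ β / β * (omegaH H δ γ ξ * ξ ^ (-β))) := by
    rw [integral_const_mul, integral_Ioi_rpow_of_lt (by linarith) (by positivity),
      show -1 - β + 1 = -β by ring, div_rpow hξ.le zero_le_two, rpow_neg zero_le_two]
    field_simp
  unfold Upsilon
  linarith

/-- the analytic core of Proposition 5.3; here `U ≤ 0` stands for the
improved dissipation term `Υ_β^⊥`. -/
theorem stmt1 (ν A cβ α β γ : ℝ) (hν : 0 < ν) (hA : 0 < A) (hcβ : 0 < cβ)
    (hα : α ∈ Set.Ioo (0 : ℝ) 1) (hβ : β ∈ Set.Ioo α 2)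
    (hγ : γ ∈ Set.Ioo (0 : ℝ) 1) (hγ' : α + 1 - β < γ) :
    ∃ C₁ > (0 : ℝ), ∀ H δ : ℝ, 0 < H → 0 < δ → H ≤ C₁ * δ ^ (α + 1 - β) →
      ∀ ξ ∈ Set.Ioc (0 : ℝ) δ, ∀ U ≤ (0 : ℝ),
        A * (-(ξ ^ (β - α)) * U + ξ ^ (-α) * omegaH H δ γ ξ) *
            (γ * H * δ ^ (-γ) * ξ ^ (γ - 1)) +
          ν * cβ * Upsilon β (omegaH H δ γ) ξ + ν * U < 0 := by
  have hβ₀ : 0 < β := hα.1.trans hβ.1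
  have hc : 0 < (2 - (2 : ℝ) ^ γ) * 2 ^ β / β := by
    have : (2 : ℝ) ^ γ < 2 ^ (1 : ℝ) := rpow_lt_rpow_of_exponent_lt one_lt_two hγ.2
    rw [rpow_one] at this
    have : 0 < 2 - (2 : ℝ) ^ γ := by linarith
    positivity
  set c := (2 - (2 : ℝ) ^ γ) * 2 ^ β / β
  have hγ₀ := hγ.1
  refine ⟨min ν (ν * cβ * c) / (2 * (A * γ)), by positivity, ?_⟩
  intro H δ hH hδ hHδ ξ hξ U hU
  obtain ⟨hξ₀, hξδ⟩ := hξ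
  have hΥ := Upsilon_omegaH_le hβ₀ hγ₀.le hγ.2.le hH.le hξ₀ hξδ
  have hω : 0 < omegaH H δ γ ξ := by
    unfold omegaH
    rw [if_pos hξδ]
    positivity
  set w := omegaH H δ γ ξ
  set Y := Upsilon β (omegaH H δ γ) ξ
  set E := H * δ ^ (-γ) * ξ ^ (β - α + γ - 1)
  have hE₀ : 0 < E := by positivity
  have hE : E ≤ min ν (ν * cβ * c) / (2 * (A * γ)) := by
    calc H * δ ^ (-γ) * ξ ^ (β - α + γ - 1) ≤ H * δ ^ (-γ) * δ ^ (β - α + γ - 1) := by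
          gcongr
          linarith
      _ = H * δ ^ (-(α + 1 - β)) := by
          rw [mul_assoc, ← rpow_add hδ]
          congr 2
          ring
      _ ≤ min ν (ν * cβ * c) / (2 * (A * γ)) * δ ^ (α + 1 - β) * δ ^ (-(α + 1 - β)) := by
          gcongr
      _ = min ν (ν * cβ * c) / (2 * (A * γ)) := by
          rw [mul_assoc, ← rpow_add hδ, add_neg_cancel, rpow_zero, mul_one]
  have hAE : 2 * (A * γ * E) ≤ min ν (ν * cβ * c) := by
    rw [le_div_iff₀ (by positivity)] at hE
    linarith
  have hAE₀ : 0 < A * γ * E := by positivity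
  have h₁ : A * γ * E ≤ ν := by linarith [min_le_left ν (ν * cβ * c)]
  have h₂ : A * γ * E < ν * cβ * c := by linarith [min_le_right ν (ν * cβ * c)]
  have e₁ : ξ ^ (β - α) * ξ ^ (γ - 1) = ξ ^ (β - α + γ - 1) := by
    rw [← rpow_add hξ₀]
    congr 1
    ring
  have e₂ : ξ ^ (-α) * ξ ^ (γ - 1) = ξ ^ (-β) * ξ ^ (β - α + γ - 1) := by
    rw [← rpow_add hξ₀, ← rpow_add hξ₀]
    congr 1
    ring
  have hid : A * (-(ξ ^ (β - α)) * U + ξ ^ (-α) * w) * (γ * H * δ ^ (-γ) * ξ ^ (γ - 1)) =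
      -(A * γ * E) * U + A * γ * E * (w * ξ ^ (-β)) := by
    linear_combination (-(A * γ * H * δ ^ (-γ) * U)) * e₁ + A * γ * H * δ ^ (-γ) * w * e₂
  have hU' : (ν - A * γ * E) * U ≤ 0 := mul_nonpos_of_nonneg_of_nonpos (by linarith) hU
  have hlt : A * γ * E * (w * ξ ^ (-β)) < ν * cβ * c * (w * ξ ^ (-β)) := by gcongr
  have hY : ν * cβ * Y ≤ ν * cβ * -(c * (w * ξ ^ (-β))) := by gcongr
  rw [hid]
  linarith
end

section
/- Let ν > 0, A > 0, c_β > 0, α ∈ (0,1), β ∈ (α, 2), and γ ∈ (0,1) with γ > α + 1 − β. Then there exist constants C₁ > 0 and C₂ > 0, depending only on α, β, γ, ν, A, c_β, such that for all H, δ > 0 with H ≤ C₁ δ^{α+1−β}, for every ξ₀ ∈ (0, δ], every ξ ∈ (0, ξ₀] and every real number U ≤ 0, one has C₂ · γ(1−γ) H δ^{−γ} (ξ₀^{γ−1} − ξ₀^{γ−2} ξ) ξ₀^{1−β} + A·(−ξ^{β−α} U + ξ^{−α} ω(ξ;ξ₀)) · γ H δ^{−γ} ξ₀^{γ−1} + ν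 c_β · Υ_β[ω(·;ξ₀)](ξ) + ν U < 0. -/
open MeasureTheory Set Real

/-- The variant modulus of continuity `ω(·;ξ₀)` from (5.5):
`ω(ξ;ξ₀) = γHδ^{−γ}ξ₀^{γ−1}ξ + (1−γ)Hδ^{−γ}ξ₀^γ` for `0 < ξ ≤ ξ₀`,
`ω(ξ;ξ₀) = (H/δ^γ)ξ^γ` for `ξ₀ < ξ ≤ δ`, and `ω(ξ;ξ₀) = H` for `ξ > δ`. -/
noncomputable def omegaVar (H δ γ ξ₀ ξ : ℝ) : ℝ :=
  if ξ ≤ ξ₀ then γ * H * δ ^ (-γ) * ξ₀ ^ (γ - 1) * ξ + (1 - γ) * H * δ ^ (-γ) * ξ₀ ^ γ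
  else if ξ ≤ δ then H / δ ^ γ * ξ ^ γ
  else H

/-- Tangent-line bound for the concave power `x ^ γ`, with the slope taken at a point `t ≤ y`. -/
lemma rpow_le_rpow_add_slope {γ t x y : ℝ} (hγ : γ ∈ Set.Ioo (0 : ℝ) 1) (ht : 0 < t)
    (hty : t ≤ y) (hyx : y ≤ x) : x ^ γ ≤ y ^ γ + γ * t ^ (γ - 1) * (x - y) := by
  obtain ⟨hγ0, hγ1⟩ := hγ
  have hy : 0 < y := ht.trans_le hty
  have hxy : 0 ≤ x / y := div_nonneg (hy.le.trans hyx) hy.le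
  have hbern := rpow_one_add_le_one_add_mul_self (s := x / y - 1) (by linarith) hγ0.le hγ1.le
  have hslope : y ^ (γ - 1) ≤ t ^ (γ - 1) :=
    Real.rpow_le_rpow_of_nonpos ht hty (by linarith)
  have hpow : y ^ (γ - 1) = y ^ γ / y := Real.rpow_sub_one hy.ne' γ
  calc x ^ γ = y ^ γ * (1 + (x / y - 1)) ^ γ := by
        rw [← Real.mul_rpow hy.le (by linarith)]
        congr 1
        field_simp
        ring
    _ ≤ y ^ γ * (1 + γ * (x / y - 1)) := by gcongr
    _ = y ^ γ + γ * y ^ (γ - 1) * (x - y) := by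
        rw [hpow]
        field_simp
    _ ≤ y ^ γ + γ * t ^ (γ - 1) * (x - y) := by
        have : 0 ≤ x - y := sub_nonneg.2 hyx
        gcongr

section omegaVar

variable {H δ γ ξ₀ : ℝ}

lemma omegaVar_of_le {x : ℝ} (hx : x ≤ ξ₀) :
    omegaVar H δ γ ξ₀ x =
      H * δ ^ (-γ) * (γ * ξ₀ ^ (γ - 1) * x + (1 - γ) * ξ₀ ^ γ) := by
  rw [omegaVar, if_pos hx]
  ring

lemma omegaVar_of_lt {x : ℝ} (hδ : 0 < δ) (hx : ξ₀ < x) :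
    omegaVar H δ γ ξ₀ x = H * δ ^ (-γ) * min x δ ^ γ := by
  rw [omegaVar, if_neg hx.not_ge, Real.rpow_neg hδ.le]
  split_ifs with h
  · rw [min_eq_left h]
    ring
  · have : δ ^ γ ≠ 0 := (Real.rpow_pos_of_pos hδ γ).ne'
    rw [min_eq_right (not_le.1 h).le]
    field_simp

lemma omegaVar_le_line (hH : 0 < H) (hδ : 0 < δ) (hγ : γ ∈ Set.Ioo (0 : ℝ) 1)
    (hξ₀ : ξ₀ ∈ Set.Ioc 0 δ) (x : ℝ) :
    omegaVar H δ γ ξ₀ x ≤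
      H * δ ^ (-γ) * (γ * ξ₀ ^ (γ - 1) * x + (1 - γ) * ξ₀ ^ γ) := by
  rcases le_or_gt x ξ₀ with hx | hx
  · exact (omegaVar_of_le hx).le
  · have hξ₀' := hξ₀.1
    have hγ0 := hγ.1
    rw [omegaVar_of_lt hδ hx]
    gcongr
    have h1 := rpow_le_rpow_add_slope hγ hξ₀.1 le_rfl (le_min hx.le hξ₀.2)
    have h2 : γ * ξ₀ ^ (γ - 1) * min x δ ≤ γ * ξ₀ ^ (γ - 1) * x := by
      gcongr
      exact min_le_left _ _
    have h3 : ξ₀ ^ (γ - 1) * ξ₀ = ξ₀ ^ γ := by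
      rw [Real.rpow_sub_one hξ₀.1.ne', div_mul_cancel₀ _ hξ₀.1.ne']
    linear_combination h1 + h2 - γ * h3

lemma omegaVar_sub_le (hH : 0 < H) (hδ : 0 < δ) (hγ : γ ∈ Set.Ioo (0 : ℝ) 1)
    (hξ₀ : ξ₀ ∈ Set.Ioc 0 δ) {x y : ℝ} (hyx : y ≤ x) :
    omegaVar H δ γ ξ₀ x - omegaVar H δ γ ξ₀ y ≤
      H * δ ^ (-γ) * (γ * ξ₀ ^ (γ - 1) * (x - y)) := by
  rcases le_or_gt y ξ₀ with hy | hy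
  · linear_combination omegaVar_le_line hH hδ hγ hξ₀ x - omegaVar_of_le (H := H) (δ := δ)
      (γ := γ) hy
  · have hξ₀' := hξ₀.1
    have hγ0 := hγ.1
    rw [omegaVar_of_lt hδ hy, omegaVar_of_lt hδ (hy.trans_le hyx), ← mul_sub]
    gcongr
    have h1 := rpow_le_rpow_add_slope hγ hξ₀.1 (le_min hy.le hξ₀.2) (min_le_min_right δ hyx)
    have h2 : min x δ - min y δ ≤ x - y := by
      rcases le_total x δ with h | h <;> rcases le_total y δ with h' | h' <;>
        simp only [min_eq_left, min_eq_right, h, h'] <;> linarith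
    have h3 : γ * ξ₀ ^ (γ - 1) * (min x δ - min y δ) ≤ γ * ξ₀ ^ (γ - 1) * (x - y) := by
      gcongr
    linarith

lemma omegaVar_nonneg (hH : 0 < H) (hδ : 0 < δ) (hγ : γ ∈ Set.Ioo (0 : ℝ) 1)
    (hξ₀ : 0 < ξ₀) {x : ℝ} (hx : 0 ≤ x) : 0 ≤ omegaVar H δ γ ξ₀ x := by
  have hγ0 := hγ.1
  have hγ1 : 0 < 1 - γ := sub_pos.2 hγ.2
  rcases le_or_gt x ξ₀ with h | h
  · rw [omegaVar_of_le h]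
    positivity
  · rw [omegaVar_of_lt hδ h]
    positivity

lemma omegaVar_le_of_le (hH : 0 < H) (hδ : 0 < δ) (hγ : 0 < γ) (hξ₀ : 0 < ξ₀) {x : ℝ}
    (hx : x ≤ ξ₀) : omegaVar H δ γ ξ₀ x ≤ H * δ ^ (-γ) * ξ₀ ^ γ := by
  have h1 : γ * ξ₀ ^ (γ - 1) * x ≤ γ * ξ₀ ^ (γ - 1) * ξ₀ := by gcongr
  have h2 : ξ₀ ^ (γ - 1) * ξ₀ = ξ₀ ^ γ := by
    rw [Real.rpow_sub_one hξ₀.ne', div_mul_cancel₀ _ hξ₀.ne']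
  rw [omegaVar_of_le hx]
  gcongr
  linear_combination h1 + γ * h2

lemma omegaVar_le (hH : 0 < H) (hδ : 0 < δ) (hγ : 0 < γ) (hξ₀ : ξ₀ ∈ Set.Ioc 0 δ) (x : ℝ) :
    omegaVar H δ γ ξ₀ x ≤ H := by
  have hξ₀' := hξ₀.1
  have key : H * δ ^ (-γ) * δ ^ γ = H := by
    rw [mul_assoc, ← Real.rpow_add hδ, neg_add_cancel, Real.rpow_zero, mul_one]
  rcases le_or_gt x ξ₀ with h | h
  · refine (omegaVar_le_of_le hH hδ hγ hξ₀.1 h).trans (le_of_le_of_eq ?_ key)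
    gcongr
    exact hξ₀.2
  · rw [omegaVar_of_lt hδ h]
    refine le_of_le_of_eq ?_ key
    gcongr
    · exact le_min (hξ₀'.trans h).le hδ.le
    · exact min_le_right _ _

lemma measurable_omegaVar : Measurable (omegaVar H δ γ ξ₀) := by
  unfold omegaVar
  refine Measurable.ite measurableSet_Iic (by fun_prop) ?_
  exact Measurable.ite measurableSet_Iic (by fun_prop) (by fun_prop)

lemma Upsilon_omegaVar_le {β ξ : ℝ} (hβ : 0 < β) (hH : 0 < H) (hδ : 0 < δ)
    (hγ : γ ∈ Set.Ioo (0 : ℝ) 1) (hξ₀ : ξ₀ ∈ Set.Ioc 0 δ) (hξ : ξ ∈ Set.Ioc 0 ξ₀) :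
    Upsilon β (omegaVar H δ γ ξ₀) ξ ≤
      -(2 * (1 - γ) / β * (H * δ ^ (-γ) * ξ₀ ^ γ * (ξ / 2) ^ (-β))) := by
  obtain ⟨hξpos, hξle⟩ := hξ
  have hhalf : 0 < ξ / 2 := by positivity
  have near : ∫ η in Set.Ioc (0 : ℝ) (ξ / 2), (omegaVar H δ γ ξ₀ (ξ + 2 * η) +
      omegaVar H δ γ ξ₀ (ξ - 2 * η) - 2 * omegaVar H δ γ ξ₀ ξ) / η ^ (1 + β) ≤ 0 := by
    refine setIntegral_nonpos measurableSet_Ioc fun η hη => ?_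
    refine div_nonpos_of_nonpos_of_nonneg ?_ (Real.rpow_nonneg hη.1.le _)
    have h1 := omegaVar_le_line hH hδ hγ hξ₀ (ξ + 2 * η)
    have h2 := omegaVar_le_line hH hδ hγ hξ₀ (ξ - 2 * η)
    linear_combination h1 + h2 - 2 * omegaVar_of_le (H := H) (δ := δ) (γ := γ) hξle
  have hint : IntegrableOn (fun η : ℝ => η ^ (-(1 + β))) (Set.Ioi (ξ / 2)) :=
    integrableOn_Ioi_rpow_of_lt (by linarith) hhalf
  have far : ∫ η in Set.Ioi (ξ / 2), (omegaVar H δ γ ξ₀ (2 * η + ξ) -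
      omegaVar H δ γ ξ₀ (2 * η - ξ) - 2 * omegaVar H δ γ ξ₀ ξ) / η ^ (1 + β) ≤
      ∫ η in Set.Ioi (ξ / 2), -(2 * (1 - γ) * (H * δ ^ (-γ) * ξ₀ ^ γ)) * η ^ (-(1 + β)) := by
    refine setIntegral_mono_on ?_ (hint.const_mul _) measurableSet_Ioi fun η hη => ?_
    · refine (hint.const_mul (4 * H)).mono' ?_ ?_
      · have := measurable_omegaVar (H := H) (δ := δ) (γ := γ) (ξ₀ := ξ₀)
        exact Measurable.aestronglyMeasurable (by fun_prop)
      · refine (ae_restrict_iff' measurableSet_Ioi).2 (.of_forall fun η hη => ?_)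
        have hη' : ξ / 2 < η := hη
        have hηpos : 0 < η := hhalf.trans hη'
        rw [Real.rpow_neg hηpos.le, ← div_eq_mul_inv, Real.norm_eq_abs, abs_div,
          abs_of_pos (Real.rpow_pos_of_pos hηpos (1 + β))]
        have a1 := omegaVar_nonneg hH hδ hγ hξ₀.1 (x := 2 * η + ξ) (by linarith)
        have a2 := omegaVar_nonneg hH hδ hγ hξ₀.1 (x := 2 * η - ξ) (by linarith)
        have a3 := omegaVar_nonneg hH hδ hγ hξ₀.1 hξpos.le
        have b1 := omegaVar_le hH hδ hγ.1 hξ₀ (2 * η + ξ)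
        have b2 := omegaVar_le hH hδ hγ.1 hξ₀ (2 * η - ξ)
        have b3 := omegaVar_le hH hδ hγ.1 hξ₀ ξ
        gcongr
        exact abs_le.2 ⟨by linarith, by linarith⟩
    · have hηpos : 0 < η := hhalf.trans hη
      rw [Real.rpow_neg hηpos.le, ← div_eq_mul_inv]
      gcongr
      have h1 := omegaVar_sub_le hH hδ hγ hξ₀ (x := 2 * η + ξ) (y := 2 * η - ξ) (by linarith)
      linear_combination h1 - 2 * omegaVar_of_le (H := H) (δ := δ) (γ := γ) hξle
  rw [integral_const_mul, integral_Ioi_rpow_of_lt (by linarith) hhalf,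
    show -(1 + β) + 1 = -β by ring] at far
  rw [Upsilon]
  refine (add_le_add near far).trans (le_of_eq ?_)
  field_simp
  ring

end omegaVar

/-- the analytic core of Lemma 5.4; the first term is `−∂_t ω(ξ;ξ₀(t))`
when `ξ₀' = −C₂ ξ₀^{1−β}`, and `U ≤ 0` stands for the improved dissipation term `Υ_β^⊥`. -/
theorem stmt2 (ν A cβ α β γ : ℝ) (hν : 0 < ν) (hA : 0 < A) (hcβ : 0 < cβ)
    (hα : α ∈ Set.Ioo (0 : ℝ) 1) (hβ : β ∈ Set.Ioo α 2)
    (hγ : γ ∈ Set.Ioo (0 : ℝ) 1) (hγ' : α + 1 - β < γ) :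
    ∃ C₁ > (0 : ℝ), ∃ C₂ > (0 : ℝ),
      ∀ H δ : ℝ, 0 < H → 0 < δ → H ≤ C₁ * δ ^ (α + 1 - β) →
        ∀ ξ₀ ∈ Set.Ioc (0 : ℝ) δ, ∀ ξ ∈ Set.Ioc (0 : ℝ) ξ₀, ∀ U ≤ (0 : ℝ),
          C₂ * (γ * (1 - γ) * H * δ ^ (-γ) * (ξ₀ ^ (γ - 1) - ξ₀ ^ (γ - 2) * ξ)) *
              ξ₀ ^ (1 - β) +
            A * (-(ξ ^ (β - α)) * U + ξ ^ (-α) * omegaVar H δ γ ξ₀ ξ) *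
              (γ * H * δ ^ (-γ) * ξ₀ ^ (γ - 1)) +
            ν * cβ * Upsilon β (omegaVar H δ γ ξ₀) ξ + ν * U < 0 := by
  obtain ⟨hα0, hα1⟩ := hα
  obtain ⟨hαβ, hβ2⟩ := hβ
  have hβ0 : 0 < β := hα0.trans hαβ
  have hγ0 := hγ.1
  have hγ1 : 0 < 1 - γ := sub_pos.2 hγ.2
  set c : ℝ := ν * cβ * (2 * (1 - γ) / β) with hc
  have hcpos : 0 < c := by positivity
  refine ⟨min (ν / A) (c / (4 * A)), by positivity, c / 4, by positivity, ?_⟩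
  intro H δ hH hδ hHδ ξ₀ hξ₀ ξ hξ U hU
  have hξ₀pos := hξ₀.1
  have hξpos := hξ.1
  set K : ℝ := H * δ ^ (-γ) * ξ₀ ^ γ * ξ ^ (-β) with hK
  have hKpos : 0 < K := by positivity
  set S : ℝ := H * δ ^ (-γ) * ξ₀ ^ (γ - 1) * ξ ^ (β - α) with hS
  have hSpos : 0 < S := by positivity
  have hSle : S ≤ min (ν / A) (c / (4 * A)) := by
    calc S ≤ H * δ ^ (-γ) * ξ₀ ^ (γ - 1) * ξ₀ ^ (β - α) := by
          have := Real.rpow_le_rpow hξpos.le hξ.2 (sub_pos.2 hαβ).le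
          rw [hS]
          gcongr
      _ = H * δ ^ (-γ) * ξ₀ ^ (γ - (α + 1 - β)) := by
          rw [mul_assoc, ← Real.rpow_add hξ₀pos]
          ring_nf
      _ ≤ H * δ ^ (-γ) * δ ^ (γ - (α + 1 - β)) := by
          have := Real.rpow_le_rpow hξ₀pos.le hξ₀.2 (sub_pos.2 hγ').le
          gcongr
      _ = H * δ ^ (-(α + 1 - β)) := by
          rw [mul_assoc, ← Real.rpow_add hδ]
          ring_nf
      _ ≤ min (ν / A) (c / (4 * A)) * δ ^ (α + 1 - β) * δ ^ (-(α + 1 - β)) := by gcongr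
      _ = min (ν / A) (c / (4 * A)) := by
          rw [mul_assoc, ← Real.rpow_add hδ, add_neg_cancel, Real.rpow_zero, mul_one]
  have hAS : A * S ≤ ν := by
    have := hSle.trans (min_le_left _ _)
    rwa [le_div_iff₀ hA, mul_comm] at this
  have hAS' : A * S ≤ c / 4 := by
    have := hSle.trans (min_le_right _ _)
    rw [le_div_iff₀ (by positivity)] at this
    linarith
  have drift : c / 4 * (γ * (1 - γ) * H * δ ^ (-γ) * (ξ₀ ^ (γ - 1) - ξ₀ ^ (γ - 2) * ξ)) *
      ξ₀ ^ (1 - β) ≤ c / 4 * K := by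
    have hγγ : γ * (1 - γ) ≤ 1 := by nlinarith
    have hpow : ξ₀ ^ (-β) ≤ ξ ^ (-β) := Real.rpow_le_rpow_of_nonpos hξpos hξ.2 (by linarith)
    calc _ ≤ c / 4 * (γ * (1 - γ) * H * δ ^ (-γ) * ξ₀ ^ (γ - 1)) * ξ₀ ^ (1 - β) := by
          gcongr
          exact sub_le_self _ (by positivity)
      _ = γ * (1 - γ) * (c / 4 * (H * δ ^ (-γ) * ξ₀ ^ γ * ξ₀ ^ (-β))) := by
          have : ξ₀ ^ (γ - 1) * ξ₀ ^ (1 - β) = ξ₀ ^ γ * ξ₀ ^ (-β) := by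
            rw [← Real.rpow_add hξ₀pos, ← Real.rpow_add hξ₀pos]
            ring_nf
          linear_combination c / 4 * (γ * (1 - γ) * H * δ ^ (-γ)) * this
      _ ≤ 1 * (c / 4 * K) := by
          rw [hK]
          gcongr
      _ = c / 4 * K := one_mul _
  have transport : A * (ξ ^ (-α) * omegaVar H δ γ ξ₀ ξ) * (γ * H * δ ^ (-γ) * ξ₀ ^ (γ - 1)) ≤
      c / 4 * K := by
    have hω := omegaVar_le_of_le hH hδ hγ0 hξ₀pos hξ.2
    calc _ ≤ A * (ξ ^ (-α) * (H * δ ^ (-γ) * ξ₀ ^ γ)) * (γ * H * δ ^ (-γ) * ξ₀ ^ (γ - 1)) := by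
          gcongr
      _ = γ * (A * S) * K := by
          have : ξ ^ (-α) = ξ ^ (-β) * ξ ^ (β - α) := by
            rw [← Real.rpow_add hξpos]
            ring_nf
          rw [this]
          ring
      _ ≤ 1 * (c / 4) * K := by
          have := hγ.2.le
          gcongr
      _ = c / 4 * K := by ring
  have improved : A * (-(ξ ^ (β - α)) * U) * (γ * H * δ ^ (-γ) * ξ₀ ^ (γ - 1)) + ν * U ≤ 0 := by
    have h1 : γ * (A * S) ≤ ν :=
      (mul_le_of_le_one_left (by positivity) hγ.2.le).trans hAS
    have h2 := mul_nonpos_of_nonneg_of_nonpos (sub_nonneg.2 h1) hU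
    rw [hS] at h2
    linear_combination h2
  have dissipation : ν * cβ * Upsilon β (omegaVar H δ γ ξ₀) ξ ≤ -(c * K) := by
    have hpow : ξ ^ (-β) ≤ (ξ / 2) ^ (-β) :=
      Real.rpow_le_rpow_of_nonpos (by positivity) (by linarith) (by linarith)
    have hY := Upsilon_omegaVar_le hβ0 hH hδ hγ hξ₀ hξ
    calc _ ≤ ν * cβ * -(2 * (1 - γ) / β * (H * δ ^ (-γ) * ξ₀ ^ γ * (ξ / 2) ^ (-β))) := by
          gcongr
      _ ≤ ν * cβ * -(2 * (1 - γ) / β * K) := by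
          rw [hK]
          gcongr
      _ = -(c * K) := by
          rw [hc]
          ring
  linear_combination drift + transport + improved + dissipation + mul_pos hcpos hKpos / 2
end

section
/- Let α, β be real numbers with β > α + 1. Let ω : (0,∞) → (0,∞) be concave and nondecreasing, and let R > 0, c₀ > 0 satisfy ω(R) ≥ c₀. Let θ₀ : ℝ² → ℝ, M > 0 and L ≥ 0 satisfy |θ₀(x)| ≤ M for all x and |θ₀(x) − θ₀(y)| ≤ L‖x − y‖ for all x, y. Then for every λ ≥ max{ (4M/c₀)^{1/(β−α−1)}, RL/M } and all x ≠ y in ℝ²: |θ₀(x) − θ₀(y)| < λ^{β−α−1} ω(λ‖x − y‖). -/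
open Set Real

/-- A positive concave function on `(0, ∞)` lies above half of its chord from the origin. -/
theorem ConcaveOn.half_chord_le {f : ℝ → ℝ} (hf : ConcaveOn ℝ (Set.Ioi 0) f)
    (hpos : ∀ x > (0 : ℝ), 0 < f x) {x R : ℝ} (hx : 0 < x) (hxR : x ≤ R) :
    x / (2 * R) * f R ≤ f x := by
  have hR : 0 < R := hx.trans_le hxR
  have hb : 0 < x / (2 * R) := by positivity
  have ha : 0 < 1 - x / (2 * R) := by
    rw [sub_pos, div_lt_one (by positivity)]
    linarith
  have hu : 0 < x / 2 / (1 - x / (2 * R)) := by positivity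
  have h := hf.2 (Set.mem_Ioi.2 hu) (Set.mem_Ioi.2 hR) ha.le hb.le (by ring)
  have hcomb : (1 - x / (2 * R)) * (x / 2 / (1 - x / (2 * R))) + x / (2 * R) * R = x := by
    rw [mul_div_cancel₀ _ ha.ne']
    field_simp
    ring
  simp only [smul_eq_mul, hcomb] at h
  have := mul_pos ha (hpos _ hu)
  linarith

/-- the initial data obeys the rescaled modulus of continuity
`ω_λ(ξ) := λ^{β−α−1} ω(λξ)` once `λ ≥ max{(4M/c₀)^{1/(β−α−1)}, RL/M}` (Section 4,
equation (4.18)). -/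
theorem stmt3 (α β : ℝ) (hβ : α + 1 < β)
    (ω : ℝ → ℝ) (hconc : ConcaveOn ℝ (Set.Ioi 0) ω)
    (hmono : MonotoneOn ω (Set.Ioi 0)) (hωpos : ∀ ξ > (0 : ℝ), 0 < ω ξ)
    (R c₀ : ℝ) (hR : 0 < R) (hc₀ : 0 < c₀) (hωR : c₀ ≤ ω R)
    (θ₀ : EuclideanSpace ℝ (Fin 2) → ℝ) (M L : ℝ) (hM : 0 < M) (hL : 0 ≤ L)
    (hbd : ∀ x, |θ₀ x| ≤ M) (hlip : ∀ x y, |θ₀ x - θ₀ y| ≤ L * ‖x - y‖)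
    (lam : ℝ)
    (hlam : max ((4 * M / c₀) ^ (1 / (β - α - 1))) (R * L / M) ≤ lam) :
    ∀ x y : EuclideanSpace ℝ (Fin 2), x ≠ y →
      |θ₀ x - θ₀ y| < lam ^ (β - α - 1) * ω (lam * ‖x - y‖) := by
  intro x y hxy
  have hd : 0 < ‖x - y‖ := norm_pos_iff.2 (sub_ne_zero.2 hxy)
  have hp : 0 < β - α - 1 := by linarith
  have hq : 0 < 4 * M / c₀ := by positivity
  have hl₁ : (4 * M / c₀) ^ (1 / (β - α - 1)) ≤ lam := (le_max_left _ _).trans hlam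
  have hl₂ : R * L ≤ lam * M := (div_le_iff₀ hM).1 ((le_max_right _ _).trans hlam)
  have hlam0 : 0 < lam := (rpow_pos_of_pos hq _).trans_le hl₁
  have hpow : 4 * M / c₀ ≤ lam ^ (β - α - 1) := by
    have h := rpow_le_rpow (rpow_nonneg hq.le _) hl₁ hp.le
    rwa [← rpow_mul hq.le, one_div_mul_cancel hp.ne', rpow_one] at h
  have hξ : 0 < lam * ‖x - y‖ := mul_pos hlam0 hd
  have hlarge : 4 * M ≤ lam ^ (β - α - 1) * ω R :=
    ((div_le_iff₀ hc₀).1 hpow).trans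
      (mul_le_mul_of_nonneg_left hωR (rpow_nonneg hlam0.le _))
  rcases le_total R (lam * ‖x - y‖) with hfar | hnear
  · calc |θ₀ x - θ₀ y| ≤ |θ₀ x| + |θ₀ y| := abs_sub _ _
      _ < 4 * M := by linarith [hbd x, hbd y]
      _ ≤ lam ^ (β - α - 1) * ω R := hlarge
      _ ≤ lam ^ (β - α - 1) * ω (lam * ‖x - y‖) :=
        mul_le_mul_of_nonneg_left (hmono hR hξ hfar) (rpow_nonneg hlam0.le _)
  · calc |θ₀ x - θ₀ y| ≤ L * ‖x - y‖ := hlip x y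
      _ ≤ lam * ‖x - y‖ / R * M := by
        rw [div_mul_eq_mul_div, le_div_iff₀ hR]
        nlinarith [mul_le_mul_of_nonneg_right hl₂ hd.le]
      _ < lam * ‖x - y‖ / (2 * R) * (4 * M) := by
        have : 0 < lam * ‖x - y‖ / R * M := by positivity
        have h : lam * ‖x - y‖ / (2 * R) * (4 * M) = 2 * (lam * ‖x - y‖ / R * M) := by
          field_simp
          ring
        linarith
      _ ≤ lam * ‖x - y‖ / (2 * R) * (lam ^ (β - α - 1) * ω R) :=
        mul_le_mul_of_nonneg_left hlarge (by positivity)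
      _ = lam ^ (β - α - 1) * (lam * ‖x - y‖ / (2 * R) * ω R) := by ring
      _ ≤ lam ^ (β - α - 1) * ω (lam * ‖x - y‖) :=
        mul_le_mul_of_nonneg_left (hconc.half_chord_le hωpos hξ hnear)
          (rpow_nonneg hlam0.le _)
end

section
/- Let n ≥ 1, let f : ℝⁿ → ℝ be differentiable, let ω : (0,∞) → (0,∞), and suppose f(x) − f(y) ≤ ω(‖x − y‖) for all x ≠ y. Suppose there are points x̄ ≠ ȳ with f(x̄) − f(ȳ) = ω(ξ̄), where ξ̄ := ‖x̄ − ȳ‖, and suppose ω is differentiable at ξ̄. Set ℓ := (x̄ − ȳ)/ξ̄. Then ⟨∇f(x̄), ℓ⟩ = ⟨∇f(ȳ), ℓ⟩ = ω′(ξ̄), and for every vector v with ⟨v, ℓ⟩ = 0 one has ⟨∇f(x̄), v⟩ = ⟨∇f(ȳ), v⟩ = 0. -/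
open Set Real RealInnerProductSpace

/-- The norm of a real inner product space has derivative `⟪z, ·⟫ / ‖z‖` at `z ≠ 0`. -/
theorem hasFDerivAt_norm_of_ne_zero {E : Type*} [NormedAddCommGroup E] [InnerProductSpace ℝ E]
    {z : E} (hz : z ≠ 0) :
    HasFDerivAt (fun x : E => ‖x‖) (‖z‖⁻¹ • innerSL ℝ z) z := by
  have hz' : ‖z‖ ≠ 0 := norm_ne_zero_iff.mpr hz
  have h := (hasStrictFDerivAt_norm_sq z).hasFDerivAt.sqrt (pow_ne_zero 2 hz')
  simp only [Real.sqrt_sq (norm_nonneg _)] at h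
  convert h using 1
  ext v
  simp
  field_simp

/-- If `f - ω ‖· - b‖` has a global maximum over `x ≠ b` at `a ≠ b`, then the derivative of `f`
at `a` is `ω' ⟪a - b, ·⟫ / ‖a - b‖`. -/
theorem fderiv_apply_eq_of_touching {E : Type*} [NormedAddCommGroup E] [InnerProductSpace ℝ E]
    {f : E → ℝ} {ω : ℝ → ℝ} {ω' : ℝ} {a b : E} (hab : a ≠ b) (hf : DifferentiableAt ℝ f a)
    (hω' : HasDerivAt ω ω' ‖a - b‖) (hω : ∀ x, x ≠ b → f x - f b ≤ ω ‖x - b‖)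
    (htouch : f a - f b = ω ‖a - b‖) (v : E) :
    fderiv ℝ f a v = ω' * (‖a - b‖⁻¹ * ⟪a - b, v⟫) := by
  have hmax : IsLocalMax (fun x => f x - ω ‖x - b‖) a := by
    filter_upwards [isOpen_ne.mem_nhds hab] with x hx
    linarith [hω x hx]
  have hnorm : HasFDerivAt (fun x => ‖x - b‖) (‖a - b‖⁻¹ • innerSL ℝ (a - b)) a := by
    have h := (hasFDerivAt_norm_of_ne_zero (sub_ne_zero.mpr hab)).comp a (hasFDerivAt_sub_const b)
    rwa [ContinuousLinearMap.comp_id] at h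
  have hderiv := hf.hasFDerivAt.sub (hω'.comp_hasFDerivAt a hnorm)
  have h := congrArg (fun L : E →L[ℝ] ℝ => L v) (hmax.hasFDerivAt_eq_zero hderiv)
  simpa [sub_eq_zero, inner_sub_left] using h

/-- first-order conditions at a touching point of a function with a
modulus of continuity (Proposition 3.1 breakdown scenario): with `ℓ := (x̄−ȳ)/‖x̄−ȳ‖`,
the directional derivatives of `f` at `x̄` and `ȳ` along `ℓ` both equal `ω′(ξ̄)`, and
the derivatives in directions orthogonal to `ℓ` vanish. -/
theorem stmt5 (n : ℕ) (hn : 1 ≤ n)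
    (f : EuclideanSpace ℝ (Fin n) → ℝ) (hf : Differentiable ℝ f)
    (ω : ℝ → ℝ)
    (hω : ∀ x y : EuclideanSpace ℝ (Fin n), x ≠ y → f x - f y ≤ ω ‖x - y‖)
    (xb yb : EuclideanSpace ℝ (Fin n)) (hxy : xb ≠ yb)
    (ω' : ℝ) (hω' : HasDerivAt ω ω' ‖xb - yb‖)
    (htouch : f xb - f yb = ω ‖xb - yb‖) :
    fderiv ℝ f xb ((‖xb - yb‖)⁻¹ • (xb - yb)) = ω' ∧
    fderiv ℝ f yb ((‖xb - yb‖)⁻¹ • (xb - yb)) = ω' ∧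
    ∀ v : EuclideanSpace ℝ (Fin n),
      ⟪v, (‖xb - yb‖)⁻¹ • (xb - yb)⟫ = 0 →
        fderiv ℝ f xb v = 0 ∧ fderiv ℝ f yb v = 0 := by
  have hnorm : ‖xb - yb‖ ≠ 0 := norm_ne_zero_iff.mpr (sub_ne_zero.mpr hxy)
  have hx := fderiv_apply_eq_of_touching hxy (hf xb) hω' (fun x hx => hω x yb hx) htouch
  have hy : ∀ v, fderiv ℝ f yb v = ω' * (‖xb - yb‖⁻¹ * ⟪xb - yb, v⟫) := by
    intro v
    have h := fderiv_apply_eq_of_touching (f := fun x => -f x) hxy.symm (hf yb).fun_neg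
      (by rwa [norm_sub_rev])
      (fun y hy => by
        have := hω xb y hy.symm
        rw [norm_sub_rev] at this
        linarith)
      (by rw [norm_sub_rev, ← htouch]; ring) v
    rw [fderiv_fun_neg, norm_sub_rev, ← neg_sub xb yb, inner_neg_left] at h
    simp only [neg_apply, mul_neg, neg_inj] at h
    exact h
  have hℓ : ‖xb - yb‖⁻¹ * ⟪xb - yb, ‖xb - yb‖⁻¹ • (xb - yb)⟫ = 1 := by
    rw [real_inner_smul_right, real_inner_self_eq_norm_sq]
    field_simp
  refine ⟨by rw [hx, hℓ, mul_one], by rw [hy, hℓ, mul_one], fun v hv => ?_⟩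
  rw [real_inner_smul_right, real_inner_comm] at hv
  exact ⟨by rw [hx, hv, mul_zero], by rw [hy, hv, mul_zero]⟩
end

section
/- Let ω : (0,∞) → (0,∞) be concave, nondecreasing and differentiable, let M ≥ 0, and let θ : ℝ² → ℝ be twice differentiable with Hessian operator norm bounded by M at every point. Suppose θ(x) − θ(y) ≤ ω(‖x − y‖) for all x ≠ y, and suppose θ(x₀) − θ(y₀) = ω(ξ) where ξ > 0, x₀ = (ξ/2, 0) and y₀ = (−ξ/2, 0). Then for every η > 0 and every μ ∈ ℝ: 2ω(2η) − θ(η,μ) + θ(−η,μ) − θ(η,−μ) + θ(−η,−μ) ≤ 2M((η − ξ/2)² + μ²). -/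
open Set Real

/-- The point `(a, b)` of the Euclidean plane. -/
noncomputable def pt (a b : ℝ) : EuclideanSpace ℝ (Fin 2) :=
  (WithLp.equiv 2 (Fin 2 → ℝ)).symm ![a, b]

theorem norm_image_add_sub_sub_fderiv_le {E F : Type*} [NormedAddCommGroup E] [NormedSpace ℝ E]
    [NormedAddCommGroup F] [NormedSpace ℝ F] {f : E → F} {f'' : E → E →L[ℝ] E →L[ℝ] F} {M : ℝ}
    (hf : Differentiable ℝ f) (hf'' : ∀ x, HasFDerivAt (fderiv ℝ f) (f'' x) x)
    (hM : ∀ x, ‖f'' x‖ ≤ M) (x v : E) :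
    ‖f (x + v) - f x - fderiv ℝ f x v‖ ≤ M / 2 * ‖v‖ ^ 2 := by
  have hlip (t : ℝ) (ht : 0 ≤ t) : ‖fderiv ℝ f (x + t • v) - fderiv ℝ f x‖ ≤ M * (t * ‖v‖) := by
    have h := convex_univ.norm_image_sub_le_of_norm_hasFDerivWithin_le
      (fun y _ => (hf'' y).hasFDerivWithinAt) (fun y _ => hM y) (mem_univ x)
      (mem_univ (x + t • v))
    rwa [add_sub_cancel_left, norm_smul, Real.norm_of_nonneg ht] at h
  have hline (t : ℝ) : HasDerivAt (fun t : ℝ => x + t • v) v t := by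
    simpa using ((hasDerivAt_id t).smul_const v).const_add x
  have hderiv (t : ℝ) : HasDerivAt (fun t : ℝ => f (x + t • v) - f x - t • fderiv ℝ f x v)
      (fderiv ℝ f (x + t • v) v - fderiv ℝ f x v) t := by
    have h := (((hf (x + t • v)).hasFDerivAt.comp_hasDerivAt t (hline t)).sub_const (f x)).sub
      ((hasDerivAt_id t).smul_const (fderiv ℝ f x v))
    rw [one_smul] at h
    exact h
  have hB (t : ℝ) : HasDerivAt (fun t : ℝ => M / 2 * ‖v‖ ^ 2 * t ^ 2) (M * ‖v‖ ^ 2 * t) t := by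
    refine ((hasDerivAt_pow 2 t).const_mul (M / 2 * ‖v‖ ^ 2)).congr_deriv ?_
    norm_num
    ring
  have key := image_norm_le_of_norm_deriv_right_le_deriv_boundary (a := 0) (b := 1)
    (fun t _ => (hderiv t).continuousAt.continuousWithinAt)
    (fun t _ => (hderiv t).hasDerivWithinAt) (by simp) hB
    (fun t ht => by
      calc ‖fderiv ℝ f (x + t • v) v - fderiv ℝ f x v‖
          = ‖(fderiv ℝ f (x + t • v) - fderiv ℝ f x) v‖ := by simp
        _ ≤ M * (t * ‖v‖) * ‖v‖ := ContinuousLinearMap.le_of_opNorm_le _ (hlip t ht.1) v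
        _ = M * ‖v‖ ^ 2 * t := by ring)
    (right_mem_Icc.2 zero_le_one)
  simpa using key

theorem ConcaveOn.le_add_deriv_mul_sub {S : Set ℝ} {f : ℝ → ℝ} {x y : ℝ} (hf : ConcaveOn ℝ S f)
    (hx : x ∈ S) (hy : y ∈ S) (hd : DifferentiableAt ℝ f x) :
    f y ≤ f x + deriv f x * (y - x) := by
  rcases lt_trichotomy x y with h | rfl | h
  · have := hf.slope_le_deriv hx hy h hd
    rw [slope_def_field, div_le_iff₀ (sub_pos.2 h)] at this
    linarith
  · simp
  · have := hf.deriv_le_slope hy hx h hd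
    rw [slope_def_field, le_div_iff₀ (sub_pos.2 h)] at this
    linarith

theorem pt_add (a b c d : ℝ) : pt a b + pt c d = pt (a + c) (b + d) := by
  ext i; fin_cases i <;> simp [pt]

theorem smul_pt (t a b : ℝ) : t • pt a b = pt (t * a) (t * b) := by
  ext i; fin_cases i <;> simp [pt]

theorem norm_pt_sq (a b : ℝ) : ‖pt a b‖ ^ 2 = a ^ 2 + b ^ 2 := by
  simp [EuclideanSpace.norm_sq_eq, pt, Fin.sum_univ_two]

theorem map_pt (L : EuclideanSpace ℝ (Fin 2) →L[ℝ] ℝ) (a b : ℝ) :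
    L (pt a b) = a * L (pt 1 0) + b * L (pt 0 1) := by
  have h : pt a b = a • pt 1 0 + b • pt 0 1 := by simp [smul_pt, pt_add]
  rw [h, map_add, map_smul, map_smul, smul_eq_mul, smul_eq_mul]

theorem hasDerivAt_comp_pt_zero {θ : EuclideanSpace ℝ (Fin 2) → ℝ} (hθ : Differentiable ℝ θ)
    (t : ℝ) : HasDerivAt (fun s => θ (pt s 0)) (fderiv ℝ θ (pt t 0) (pt 1 0)) t := by
  have hline : HasDerivAt (fun s : ℝ => pt s 0) (pt 1 0) t := by
    have h := (hasDerivAt_id t).smul_const (pt 1 0)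
    simpa [smul_pt] using h
  exact (hθ (pt t 0)).hasFDerivAt.comp_hasDerivAt t hline

theorem sub_le_modulus_reflect {ω : ℝ → ℝ} {θ : EuclideanSpace ℝ (Fin 2) → ℝ}
    (hmoc : ∀ x y : EuclideanSpace ℝ (Fin 2), x ≠ y → θ x - θ y ≤ ω ‖x - y‖)
    {t : ℝ} (ht : 0 < t) : θ (pt t 0) - θ (pt (-t) 0) ≤ ω (2 * t) := by
  have hsub : pt t 0 - pt (-t) 0 = pt (2 * t) 0 := by
    rw [sub_eq_iff_eq_add, pt_add]
    congr 1 <;> ring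
  have hnorm : ‖pt t 0 - pt (-t) 0‖ = 2 * t := by
    rw [hsub, ← sq_eq_sq₀ (norm_nonneg _) (by positivity), norm_pt_sq]
    ring
  have hne : pt t 0 ≠ pt (-t) 0 := by
    rw [← sub_ne_zero, ← norm_pos_iff, hnorm]
    positivity
  simpa only [hnorm] using hmoc _ _ hne

theorem fderiv_add_fderiv_eq_of_touch {ω : ℝ → ℝ} {θ : EuclideanSpace ℝ (Fin 2) → ℝ} {ξ : ℝ}
    (hξ : 0 < ξ) (hω : DifferentiableAt ℝ ω ξ) (hθ : Differentiable ℝ θ)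
    (hmoc : ∀ x y : EuclideanSpace ℝ (Fin 2), x ≠ y → θ x - θ y ≤ ω ‖x - y‖)
    (htouch : θ (pt (ξ / 2) 0) - θ (pt (-(ξ / 2)) 0) = ω ξ) :
    fderiv ℝ θ (pt (ξ / 2) 0) (pt 1 0) + fderiv ℝ θ (pt (-(ξ / 2)) 0) (pt 1 0) =
      2 * deriv ω ξ := by
  have hξ2 : 2 * (ξ / 2) = ξ := by ring
  have hω' : HasDerivAt (fun t => ω (2 * t)) (deriv ω ξ * 2) (ξ / 2) := by
    have h1 : HasDerivAt ω (deriv ω ξ) (2 * (ξ / 2)) := hξ2.symm ▸ hω.hasDerivAt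
    have h2 : HasDerivAt (fun t : ℝ => 2 * t) 2 (ξ / 2) := by
      simpa using (hasDerivAt_id (ξ / 2)).const_mul (2 : ℝ)
    exact h1.comp (ξ / 2) h2
  have hneg : HasDerivAt (fun t => θ (pt (-t) 0))
      (fderiv ℝ θ (pt (-(ξ / 2)) 0) (pt 1 0) * -1) (ξ / 2) :=
    (hasDerivAt_comp_pt_zero hθ (-(ξ / 2))).comp (ξ / 2) (hasDerivAt_neg (ξ / 2))
  have hd := (hω'.sub (hasDerivAt_comp_pt_zero hθ (ξ / 2))).add hneg
  have hmin : IsLocalMin ((fun t => ω (2 * t)) - (fun t => θ (pt t 0)) + fun t => θ (pt (-t) 0))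
      (ξ / 2) := by
    filter_upwards [lt_mem_nhds (half_pos hξ)] with t ht
    have := sub_le_modulus_reflect hmoc ht
    simp only [Pi.add_apply, Pi.sub_apply, hξ2]
    linarith
  have := hmin.hasDerivAt_eq_zero hd
  linarith


/-- the Taylor-expansion bound on the numerator `f_{ρ,a}(η,μ)` from the
proof of Lemma 5.5, at the breakdown configuration with symmetric touching points
`x₀ = (ξ/2, 0)`, `y₀ = (−ξ/2, 0)`. -/
theorem stmt7 (ω : ℝ → ℝ) (hconc : ConcaveOn ℝ (Set.Ioi 0) ω)
    (hmono : MonotoneOn ω (Set.Ioi 0)) (hdiff : DifferentiableOn ℝ ω (Set.Ioi 0))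
    (hωpos : ∀ s > (0 : ℝ), 0 < ω s)
    (M : ℝ) (hM : 0 ≤ M)
    (θ : EuclideanSpace ℝ (Fin 2) → ℝ) (hθ : Differentiable ℝ θ)
    (θ'' : EuclideanSpace ℝ (Fin 2) →
      EuclideanSpace ℝ (Fin 2) →L[ℝ] EuclideanSpace ℝ (Fin 2) →L[ℝ] ℝ)
    (hθ'' : ∀ x, HasFDerivAt (fderiv ℝ θ) (θ'' x) x)
    (hhess : ∀ x, ‖θ'' x‖ ≤ M)
    (hmoc : ∀ x y : EuclideanSpace ℝ (Fin 2), x ≠ y → θ x - θ y ≤ ω ‖x - y‖)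
    (ξ : ℝ) (hξ : 0 < ξ)
    (htouch : θ (pt (ξ / 2) 0) - θ (pt (-(ξ / 2)) 0) = ω ξ) :
    ∀ η > (0 : ℝ), ∀ μ : ℝ,
      2 * ω (2 * η) - θ (pt η μ) + θ (pt (-η) μ) - θ (pt η (-μ)) + θ (pt (-η) (-μ)) ≤
        2 * M * ((η - ξ / 2) ^ 2 + μ ^ 2) := by
  intro η hη μ
  have hω : DifferentiableAt ℝ ω ξ := (hdiff ξ hξ).differentiableAt (Ioi_mem_nhds hξ)
  have hgrad := fderiv_add_fderiv_eq_of_touch hξ hω hθ hmoc htouch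
  have htangent := hconc.le_add_deriv_mul_sub (mem_Ioi.2 hξ)
    (mem_Ioi.2 (by positivity : (0 : ℝ) < 2 * η)) hω
  have taylor (a c d : ℝ) : |θ (pt (a + c) d) - θ (pt a 0) -
      (c * fderiv ℝ θ (pt a 0) (pt 1 0) + d * fderiv ℝ θ (pt a 0) (pt 0 1))| ≤
        M / 2 * (c ^ 2 + d ^ 2) := by
    have h := norm_image_add_sub_sub_fderiv_le hθ hθ'' hhess (pt a 0) (pt c d)
    rwa [pt_add, zero_add, norm_pt_sq, map_pt, Real.norm_eq_abs] at h
  have hright (d : ℝ) := (abs_le.1 (taylor (ξ / 2) (η - ξ / 2) d)).1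
  have hleft (d : ℝ) := (abs_le.1 (taylor (-(ξ / 2)) (-(η - ξ / 2)) d)).2
  have e₁ : ξ / 2 + (η - ξ / 2) = η := by ring
  have e₂ : -(ξ / 2) + -(η - ξ / 2) = -η := by ring
  simp only [e₁, e₂] at hright hleft
  have hslope : (η - ξ / 2) * fderiv ℝ θ (pt (ξ / 2) 0) (pt 1 0) +
      (η - ξ / 2) * fderiv ℝ θ (pt (-(ξ / 2)) 0) (pt 1 0) = deriv ω ξ * (2 * η - ξ) := by
    rw [← mul_add, hgrad]
    ring
  linarith [hright μ, hright (-μ), hleft μ, hleft (-μ)]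
end

section
/- Let α ∈ (0,1), β ∈ (α+1, 2) and 0 < γ < δ ≤ 1/9. Then for every ξ ≥ δ: (∫₀^ξ ω_{δ,γ}(η) η^{−(1+α)} dη + ξ ∫_ξ^∞ ω_{δ,γ}(η) η^{−(2+α)} dη) · (γ/(4(ξ + ξ^β))) ≤ (γ/(α(1−α)δ^α)) · ω_{δ,γ}(ξ) ξ^{−β}. -/
open MeasureTheory Set Real

/-- The modulus of continuity `ω_{δ,γ}` from Section 4 (equation (4.13)). -/
noncomputable def omegaDG (β δ γ ξ : ℝ) : ℝ :=
  if ξ ≤ δ then ξ - ξ ^ ((3 : ℝ) / 2)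
  else δ - δ ^ ((3 : ℝ) / 2) + ∫ η in Set.Ioc δ ξ, γ / (4 * (η + η ^ β))

lemma rpow_three_halves_le {x : ℝ} (hx : 0 < x) (hx' : x ≤ 1 / 9) :
    x ^ ((3 : ℝ) / 2) ≤ x / 3 := by
  have h : x ^ ((3 : ℝ) / 2) = x * √x := by
    rw [Real.sqrt_eq_rpow, ← Real.rpow_one_add' hx.le (by norm_num)]
    norm_num
  have hs : √x ≤ 1 / 3 := Real.sqrt_le_iff.mpr ⟨by norm_num, by linarith⟩
  rw [h]
  nlinarith

lemma integrableOn_Ioc_div_add_rpow (β γ : ℝ) {a b : ℝ} (ha : 0 < a) :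
    IntegrableOn (fun η : ℝ => γ / (4 * (η + η ^ β))) (Ioc a b) := by
  refine (ContinuousOn.integrableOn_Icc fun x hx => ?_).mono_set Ioc_subset_Icc_self
  have hx0 : 0 < x := ha.trans_le hx.1
  have := Real.rpow_pos_of_pos hx0 β
  refine ContinuousAt.continuousWithinAt ?_
  exact continuousAt_const.div (continuousAt_const.mul
    (continuousAt_id.add (Real.continuousAt_rpow_const _ _ (Or.inl hx0.ne')))) (by simp; positivity)

lemma omegaDG_of_ge {β δ γ ξ : ℝ} (h : δ ≤ ξ) :
    omegaDG β δ γ ξ = δ - δ ^ ((3 : ℝ) / 2) + ∫ η in Ioc δ ξ, γ / (4 * (η + η ^ β)) := by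
  rcases h.eq_or_lt with rfl | h
  · simp [omegaDG]
  · simp [omegaDG, not_le.mpr h]

lemma omegaDG_add_integral {β δ γ a b : ℝ} (hδ : 0 < δ) (ha : δ ≤ a) (hab : a ≤ b) :
    omegaDG β δ γ b = omegaDG β δ γ a + ∫ η in Ioc a b, γ / (4 * (η + η ^ β)) := by
  rw [omegaDG_of_ge ha, omegaDG_of_ge (ha.trans hab), ← Ioc_union_Ioc_eq_Ioc ha hab,
    setIntegral_union (Ioc_disjoint_Ioc_of_le le_rfl) measurableSet_Ioc
      (integrableOn_Ioc_div_add_rpow β γ hδ)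
      (integrableOn_Ioc_div_add_rpow β γ (hδ.trans_le ha)), add_assoc]

lemma omegaDG_mono {β δ γ a b : ℝ} (hδ : 0 < δ) (hγ : 0 ≤ γ) (ha : δ ≤ a) (hab : a ≤ b) :
    omegaDG β δ γ a ≤ omegaDG β δ γ b := by
  rw [omegaDG_add_integral hδ ha hab, le_add_iff_nonneg_right]
  refine setIntegral_nonneg measurableSet_Ioc fun x hx => ?_
  have hx0 : 0 < x := (hδ.trans_le ha).trans hx.1
  positivity

lemma omegaDG_le_add {β δ γ a b : ℝ} (hδ : 0 < δ) (hγ : 0 ≤ γ) (ha : δ ≤ a) (hab : a ≤ b) :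
    omegaDG β δ γ b ≤ omegaDG β δ γ a + γ / (4 * a) * (b - a) := by
  have ha0 : 0 < a := hδ.trans_le ha
  rw [omegaDG_add_integral hδ ha hab]
  gcongr
  calc ∫ η in Ioc a b, γ / (4 * (η + η ^ β))
      ≤ ∫ _ in Ioc a b, γ / (4 * a) := by
        refine setIntegral_mono_on (integrableOn_Ioc_div_add_rpow β γ ha0) (by simp)
          measurableSet_Ioc fun x hx => ?_
        have := Real.rpow_pos_of_pos (ha0.trans hx.1) β
        have := hx.1
        gcongr
        linarith
    _ = γ / (4 * a) * (b - a) := by simp [hab, mul_comm]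

lemma two_thirds_le_omegaDG {β δ γ ξ : ℝ} (hδ : 0 < δ) (hδ' : δ ≤ 1 / 9) (hγ : 0 ≤ γ)
    (hξ : δ ≤ ξ) : 2 / 3 * δ ≤ omegaDG β δ γ ξ := by
  refine le_trans ?_ (omegaDG_mono hδ hγ le_rfl hξ)
  have := rpow_three_halves_le hδ hδ'
  simp only [omegaDG, le_refl, if_true]
  linarith

lemma omegaDG_nonneg {β δ γ ξ : ℝ} (hδ : 0 < δ) (hδ' : δ ≤ 1 / 9) (hγ : 0 ≤ γ) (hξ : 0 < ξ) :
    0 ≤ omegaDG β δ γ ξ := by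
  rcases le_total ξ δ with h | h
  · have := rpow_three_halves_le hξ (h.trans hδ')
    simp only [omegaDG, h, if_true]
    linarith
  · linarith [two_thirds_le_omegaDG (β := β) hδ hδ' hγ h]

lemma setIntegral_union_le_add {X : Type*} [MeasurableSpace X] {μ : Measure X} {f : X → ℝ}
    {s t : Set X} (hs : MeasurableSet s) (ht : MeasurableSet t) (hst : Disjoint s t)
    (hfs : ∀ x ∈ s, 0 ≤ f x) (hft : ∀ x ∈ t, 0 ≤ f x) :
    ∫ x in s ∪ t, f x ∂μ ≤ ∫ x in s, f x ∂μ + ∫ x in t, f x ∂μ := by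
  by_cases h : IntegrableOn f (s ∪ t) μ
  · exact (setIntegral_union hst ht (h.mono_set subset_union_left)
      (h.mono_set subset_union_right)).le
  · rw [integral_undef h]
    exact add_nonneg (setIntegral_nonneg hs hfs) (setIntegral_nonneg ht hft)

lemma setIntegral_le_of_nonneg_of_le {X : Type*} [MeasurableSpace X] {μ : Measure X} {f g : X → ℝ}
    {s : Set X} (hs : MeasurableSet s) (hf : ∀ x ∈ s, 0 ≤ f x) (hg : IntegrableOn g s μ)
    (hfg : ∀ x ∈ s, f x ≤ g x) : ∫ x in s, f x ∂μ ≤ ∫ x in s, g x ∂μ :=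
  integral_mono_of_nonneg (ae_restrict_of_forall_mem hs hf) hg (ae_restrict_of_forall_mem hs hfg)

lemma integral_Ioc_omegaDG_le {α β δ γ ξ : ℝ} (hα : 0 < α) (hα' : α < 1) (hδ : 0 < δ)
    (hδ' : δ ≤ 1 / 9) (hγ : 0 ≤ γ) (hξ : δ ≤ ξ) :
    ∫ η in Ioc 0 ξ, omegaDG β δ γ η / η ^ (1 + α) ≤
      δ ^ (-α) * δ / (1 - α) + omegaDG β δ γ ξ * (δ ^ (-α) / α) := by
  have hnn : ∀ η : ℝ, 0 < η → 0 ≤ omegaDG β δ γ η / η ^ (1 + α) := fun η hη =>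
    div_nonneg (omegaDG_nonneg hδ hδ' hγ hη) (by positivity)
  have hM : 0 ≤ omegaDG β δ γ ξ := omegaDG_nonneg hδ hδ' hγ (hδ.trans_le hξ)
  rw [← Ioc_union_Ioc_eq_Ioc hδ.le hξ]
  refine (setIntegral_union_le_add measurableSet_Ioc measurableSet_Ioc
    (Ioc_disjoint_Ioc_of_le le_rfl) (fun η hη => hnn η hη.1)
    (fun η hη => hnn η (hδ.trans hη.1))).trans (add_le_add ?_ ?_)
  · have hint : IntegrableOn (fun η : ℝ => η ^ (-α)) (Ioc 0 δ) :=
      (intervalIntegrable_iff_integrableOn_Ioc_of_le hδ.le).mp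
        (intervalIntegral.intervalIntegrable_rpow' (by linarith))
    calc _ ≤ ∫ η in Ioc 0 δ, η ^ (-α) := by
          refine setIntegral_le_of_nonneg_of_le measurableSet_Ioc (fun η hη => hnn η hη.1) hint
            fun η hη => ?_
          have h0 : 0 < η := hη.1
          have h1 : omegaDG β δ γ η ≤ η := by
            simp only [omegaDG, hη.2, if_true]
            linarith [Real.rpow_pos_of_pos h0 (3 / 2)]
          rw [div_le_iff₀ (by positivity), ← Real.rpow_add h0]
          simpa using h1
      _ = δ ^ (-α) * δ / (1 - α) := by
          rw [← intervalIntegral.integral_of_le hδ.le, integral_rpow (Or.inl (by linarith)),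
            Real.zero_rpow (by linarith), Real.rpow_add_one hδ.ne']
          ring
  · have hint : IntegrableOn (fun η : ℝ => η ^ (-(1 + α))) (Ioi δ) :=
      integrableOn_Ioi_rpow_of_lt (by linarith) hδ
    calc _ ≤ ∫ η in Ioc δ ξ, omegaDG β δ γ ξ * η ^ (-(1 + α)) := by
          refine setIntegral_le_of_nonneg_of_le measurableSet_Ioc
            (fun η hη => hnn η (hδ.trans hη.1))
            ((hint.mono_set Ioc_subset_Ioi_self).const_mul _) fun η hη => ?_
          have h0 : 0 < η := hδ.trans hη.1
          rw [Real.rpow_neg h0.le, ← div_eq_mul_inv]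
          gcongr
          exact omegaDG_mono hδ hγ hη.1.le hη.2
      _ ≤ ∫ η in Ioi δ, omegaDG β δ γ ξ * η ^ (-(1 + α)) := by
          refine setIntegral_mono_set (hint.const_mul _) ?_ Ioc_subset_Ioi_self.eventuallyLE
          refine ae_restrict_of_forall_mem measurableSet_Ioi fun η hη => ?_
          have h0 : 0 < η := hδ.trans hη
          simp only [Pi.zero_apply]
          positivity
      _ = omegaDG β δ γ ξ * (δ ^ (-α) / α) := by
          rw [integral_const_mul, integral_Ioi_rpow_of_lt (by linarith) hδ,
            show -(1 + α) + 1 = -α by ring, neg_div_neg_eq]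

lemma mul_integral_Ioi_omegaDG_le {α β δ γ ξ : ℝ} (hα : 0 < α) (hδ : 0 < δ)
    (hδ' : δ ≤ 1 / 9) (hγ : 0 ≤ γ) (hξ : δ ≤ ξ) :
    ξ * ∫ η in Ioi ξ, omegaDG β δ γ η / η ^ (2 + α) ≤
      omegaDG β δ γ ξ * (ξ ^ (-α) / (1 + α)) + γ / 4 * (ξ ^ (-α) / α) := by
  have hξ0 : 0 < ξ := hδ.trans_le hξ
  have hint₁ : IntegrableOn (fun η : ℝ => η ^ (-(2 + α))) (Ioi ξ) :=
    integrableOn_Ioi_rpow_of_lt (by linarith) hξ0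
  have hint₂ : IntegrableOn (fun η : ℝ => η ^ (-(1 + α))) (Ioi ξ) :=
    integrableOn_Ioi_rpow_of_lt (by linarith) hξ0
  calc ξ * ∫ η in Ioi ξ, omegaDG β δ γ η / η ^ (2 + α)
      ≤ ξ * ∫ η in Ioi ξ,
          (omegaDG β δ γ ξ * η ^ (-(2 + α)) + γ / (4 * ξ) * η ^ (-(1 + α))) := by
        refine mul_le_mul_of_nonneg_left (setIntegral_le_of_nonneg_of_le measurableSet_Ioi
          (fun η hη => ?_) (Integrable.add (hint₁.const_mul _) (hint₂.const_mul _))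
          fun η hη => ?_) hξ0.le
        · have h0 : 0 < η := hξ0.trans hη
          exact div_nonneg (omegaDG_nonneg hδ hδ' hγ h0) (by positivity)
        · have h0 : 0 < η := hξ0.trans hη
          have h1 : η ^ (-(1 + α)) = η ^ (-(2 + α)) * η := by
            rw [← Real.rpow_add_one h0.ne']
            ring_nf
          have h2 := omegaDG_le_add (β := β) hδ hγ hξ (le_of_lt hη)
          have h3 : 0 ≤ γ / (4 * ξ) * ξ := by positivity
          have h4 : 0 ≤ η ^ (-(2 + α)) := by positivity
          rw [h1, div_eq_mul_inv, ← Real.rpow_neg h0.le]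
          calc _ ≤ (omegaDG β δ γ ξ + γ / (4 * ξ) * η) * η ^ (-(2 + α)) := by
                gcongr
                linarith
            _ = _ := by ring
    _ = omegaDG β δ γ ξ * (ξ ^ (-α) / (1 + α)) + γ / 4 * (ξ ^ (-α) / α) := by
        rw [integral_add (hint₁.const_mul _) (hint₂.const_mul _), integral_const_mul,
          integral_const_mul, integral_Ioi_rpow_of_lt (by linarith) hξ0,
          integral_Ioi_rpow_of_lt (by linarith) hξ0,
          show -(1 + α) + 1 = -α by ring, show -(2 + α) + 1 = -α - 1 by ring,
          Real.rpow_sub_one hξ0.ne']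
        have : -α - 1 ≠ 0 := by linarith
        have : 1 + α ≠ 0 := by linarith
        field_simp
        ring

/-- the Case 2 (large `ξ`) estimate of the positive (advection)
contribution `Ω₁[ω]·ω′` from Section 4; here `γ/(4(ξ+ξ^β)) = ω_{δ,γ}′(ξ)` for `ξ > δ`. -/
theorem stmt10 (α β δ γ : ℝ) (hα : α ∈ Set.Ioo (0 : ℝ) 1)
    (hβ : β ∈ Set.Ioo (α + 1) 2) (hγ : 0 < γ) (hγδ : γ < δ) (hδ : δ ≤ 1 / 9) :
    ∀ ξ ≥ δ,
      ((∫ η in Set.Ioc (0 : ℝ) ξ, omegaDG β δ γ η / η ^ (1 + α)) +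
          ξ * ∫ η in Set.Ioi ξ, omegaDG β δ γ η / η ^ (2 + α)) *
        (γ / (4 * (ξ + ξ ^ β))) ≤
      γ / (α * (1 - α) * δ ^ α) * (omegaDG β δ γ ξ * ξ ^ (-β)) := by
  obtain ⟨hα0, hα1⟩ := hα
  intro ξ hξ
  have hδ0 : 0 < δ := hγ.trans hγδ
  have hξ0 : 0 < ξ := hδ0.trans_le hξ
  have h₁ := integral_Ioc_omegaDG_le (β := β) hα0 hα1 hδ0 hδ hγ.le hξ
  have h₂ := mul_integral_Ioi_omegaDG_le (β := β) hα0 hδ0 hδ hγ.le hξ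
  have hω := two_thirds_le_omegaDG (β := β) hδ0 hδ hγ.le hξ
  set ω := omegaDG β δ γ ξ
  have hω0 : 0 < ω := by linarith
  have hα1' : 0 < 1 - α := by linarith
  have hpow : ξ ^ (-α) ≤ δ ^ (-α) := Real.rpow_le_rpow_of_nonpos hδ0 hξ (by linarith)
  have hD : 0 < δ ^ (-α) := by positivity
  have hA : (∫ η in Ioc (0 : ℝ) ξ, omegaDG β δ γ η / η ^ (1 + α)) +
      ξ * ∫ η in Ioi ξ, omegaDG β δ γ η / η ^ (2 + α) ≤
      4 * ω * δ ^ (-α) / (α * (1 - α)) := by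
    calc _ ≤ (δ ^ (-α) * δ / (1 - α) + ω * (δ ^ (-α) / α)) +
          (ω * (ξ ^ (-α) / (1 + α)) + γ / 4 * (ξ ^ (-α) / α)) := add_le_add h₁ h₂
      _ ≤ (δ ^ (-α) * (3 / 2 * ω) / (1 - α) + ω * (δ ^ (-α) / α)) +
          (ω * (δ ^ (-α) / 1) + (3 / 2 * ω) / 4 * (δ ^ (-α) / α)) := by
        gcongr <;> linarith
      _ = ω * δ ^ (-α) * (3 / 2 * α + 11 / 8 * (1 - α) + α * (1 - α)) / (α * (1 - α)) := by
        field_simp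
        ring
      _ ≤ ω * δ ^ (-α) * 4 / (α * (1 - α)) := by
        gcongr
        nlinarith
      _ = _ := by ring
  have hB : 0 < ξ ^ β := by positivity
  calc _ ≤ 4 * ω * δ ^ (-α) / (α * (1 - α)) * (γ / (4 * ξ ^ β)) := by
        gcongr
        linarith
    _ = _ := by
        rw [Real.rpow_neg hδ0.le, Real.rpow_neg hξ0.le]
        field_simp
end
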